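/- Let c = (c₁,…,c_n) be a tuple of nonnegative integers and let w ∈ W_c. Then slow(w) = Id_c if and only if w avoids both of the patterns 231 and 221. -/

import Mathlib

lemma foldr_max_mem {w : List ℕ} (h : w ≠ []) : w.foldr max 0 ∈ w := by
  induction w with
  | nil => exact absurd rfl h
  | cons a l ih =>
    rcases eq_or_ne l [] with rfl | hl
    · simp
    · have hm := ih hl
      simp only [List.foldr_cons]
      rcases max_choice a (l.foldr max 0) with h' | h' <;> rw [h']
      · exact List.mem_cons_self
      · exact List.mem_cons_of_mem _ hm

lemma headI_mem {α : Type*} [Inhabited α] {l : List α} (h : l ≠ []) : l.headI ∈ l := by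
  cases l with
  | nil => exact absurd rfl h
  | cons a t => simp

/-- `blocks n w` is the list of maximal (possibly empty) blocks of `w`
separated by occurrences of the letter `n`; that is, if `n` occurs `k` times
in `w`, then `blocks n w = [A₁, A₂, …, A_{k+1}]` where `w = A₁ n A₂ n ⋯ n A_{k+1}`
and no `Aᵢ` contains the letter `n`. -/
def blocks (n : ℕ) : List ℕ → List (List ℕ)
  | [] => [[]]
  | a :: l =>
    if a = n then [] :: blocks n l
    else (a :: (blocks n l).headI) :: (blocks n l).tail

lemma blocks_ne_nil (n : ℕ) (w : List ℕ) : blocks n w ≠ [] := by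
  cases w with
  | nil => simp [blocks]
  | cons a l =>
    simp only [blocks]
    split <;> simp

lemma blocks_length {n : ℕ} {w : List ℕ} : ∀ {A : List ℕ}, A ∈ blocks n w →
    A.length + w.count n ≤ w.length := by
  induction w with
  | nil =>
    intro A hA
    simp only [blocks, List.mem_singleton] at hA
    subst hA; simp
  | cons a l ih =>
    intro A hA
    by_cases h : a = n
    · subst h
      simp only [blocks, if_pos rfl] at hA
      have hcc : (a :: l).count a = l.count a + 1 := by simp
      cases hA with
      | head =>
        have := List.count_le_length (a := a) (l := l)
        simp only [List.length_nil, List.length_cons, hcc]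
        omega
      | tail _ h1 =>
        have := ih h1
        simp only [List.length_cons, hcc]
        omega
    · simp only [blocks, if_neg h] at hA
      have hcc : (a :: l).count n = l.count n := by
        simp [List.count_cons, h]
      cases hA with
      | head =>
        have := ih (headI_mem (blocks_ne_nil n l))
        simp only [List.length_cons, hcc]
        omega
      | tail _ h1 =>
        have := ih (List.mem_of_mem_tail h1)
        simp only [List.length_cons, hcc]
        omega

/-- The generalized stack-sorting map `slow` (the convention in which a letter may
not sit on top of a copy of itself in the stack): `slow ε = ε`, and if
`w = A₁ n A₂ n ⋯ n A_{k+1}` where `n` is the largest letter of `w` (occurring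
`k` times) and the `Aᵢ` contain only letters smaller than `n`, then
`slow w = slow A₁ ++ slow A₂ ++ [n] ++ slow A₃ ++ [n] ++ ⋯ ++ slow A_{k+1} ++ [n]`. -/
def slow (w : List ℕ) : List ℕ :=
  if h : w = [] then []
  else
    (have : (blocks (w.foldr max 0) w).headI.length < w.length := by
      have h1 := blocks_length (headI_mem (blocks_ne_nil (w.foldr max 0) w))
      have h2 : 0 < w.count (w.foldr max 0) :=
        List.count_pos_iff.mpr (foldr_max_mem h)
      omega
     slow (blocks (w.foldr max 0) w).headI) ++
    ((blocks (w.foldr max 0) w).tail.attach.map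
      fun (A : {x // x ∈ (blocks (w.foldr max 0) w).tail}) =>
      have : A.1.length < w.length := by
        have h1 := blocks_length (List.mem_of_mem_tail A.2)
        have h2 : 0 < w.count (w.foldr max 0) :=
          List.count_pos_iff.mpr (foldr_max_mem h)
        omega
      slow A.1 ++ [w.foldr max 0]).flatten
termination_by w.length

/-- Membership in `W_c`: `w` is a word over the positive integers with exactly
`cᵢ` copies of the letter `i` for each `1 ≤ i ≤ n = c.length` (and no other letters). -/
def InW (c : List ℕ) (w : List ℕ) : Prop :=
  0 ∉ w ∧ ∀ i : ℕ, w.count (i + 1) = c.getD i 0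

/-- The identity word `Id_c = 1^{c₁} 2^{c₂} ⋯ n^{c_n}`, the unique word in `W_c`
whose letters are nondecreasing from left to right. -/
def idWord (c : List ℕ) : List ℕ :=
  ((List.range c.length).map fun i => List.replicate (c.getD i 0) (i + 1)).flatten

/-- `w` contains the pattern `231`: there are indices `a < b < c` with
`w_c < w_a < w_b`. -/
def Contains231 (w : List ℕ) : Prop :=
  ∃ a b c : ℕ, a < b ∧ b < c ∧ c < w.length ∧
    w.getD c 0 < w.getD a 0 ∧ w.getD a 0 < w.getD b 0

/-- `w` contains the pattern `221`: there are indices `a < b < c` with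
`w_c < w_a = w_b`. -/
def Contains221 (w : List ℕ) : Prop :=
  ∃ a b c : ℕ, a < b ∧ b < c ∧ c < w.length ∧
    w.getD c 0 < w.getD a 0 ∧ w.getD a 0 = w.getD b 0

lemma blocks_of_notMem {n : ℕ} {A : List ℕ} (hA : n ∉ A) : blocks n A = [A] := by
  induction A with
  | nil => rfl
  | cons a l ih =>
    simp only [List.mem_cons, not_or] at hA
    simp [blocks, Ne.symm hA.1, ih hA.2]

lemma blocks_append_cons {n : ℕ} {A : List ℕ} (hA : n ∉ A) (r : List ℕ) :
    blocks n (A ++ n :: r) = A :: blocks n r := by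
  induction A with
  | nil => simp [blocks]
  | cons a l ih =>
    simp only [List.mem_cons, not_or] at hA
    simp [blocks, Ne.symm hA.1, ih hA.2]

lemma foldr_max_eq {n : ℕ} {w : List ℕ} (hn : n ∈ w) (hle : ∀ x ∈ w, x ≤ n) :
    w.foldr max 0 = n := by
  refine le_antisymm (hle _ (foldr_max_mem (List.ne_nil_of_mem hn))) ?_
  clear hle
  induction w with
  | nil => simp at hn
  | cons a l ih =>
    rcases List.mem_cons.1 hn with rfl | h
    · simp
    · simp [ih h]

/-- The contribution to `slow (A ++ n :: r)` of the suffix `r`, where `n` is the largest letter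
and does not occur in `A`. -/
def slowTail (n : ℕ) (r : List ℕ) : List ℕ :=
  ((blocks n r).map fun B => slow B ++ [n]).flatten

lemma slow_nil : slow [] = [] := by
  rw [slow]; simp

lemma slow_append_cons {n : ℕ} {A r : List ℕ} (hA : n ∉ A) (hle : ∀ x ∈ A ++ n :: r, x ≤ n) :
    slow (A ++ n :: r) = slow A ++ slowTail n r := by
  have hmax : (A ++ n :: r).foldr max 0 = n := foldr_max_eq (by simp) hle
  have hb := blocks_append_cons hA r
  rw [slow, dif_neg (by simp)]
  simp only [List.map_attach_eq_pmap, List.pmap_eq_map, hmax, hb, slowTail, List.headI_cons,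
    List.tail_cons]

lemma slowTail_of_notMem {n : ℕ} {B : List ℕ} (hB : n ∉ B) :
    slowTail n B = slow B ++ [n] := by
  simp [slowTail, blocks_of_notMem hB]

lemma slowTail_append_cons {n : ℕ} {B : List ℕ} (hB : n ∉ B) (r : List ℕ) :
    slowTail n (B ++ n :: r) = slow B ++ n :: slowTail n r := by
  simp [slowTail, blocks_append_cons hB]

/-- Every nonempty word splits at the first occurrence of its largest letter. -/
lemma exists_split_max {w : List ℕ} (hw : w ≠ []) :
    ∃ n A r, w = A ++ n :: r ∧ n ∉ A ∧ ∀ x ∈ w, x ≤ n := by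
  obtain ⟨A, r, h, hA⟩ := List.eq_append_cons_of_mem (foldr_max_mem hw)
  refine ⟨_, A, r, h, hA, fun x hx => ?_⟩
  clear h hA hw
  induction w with
  | nil => simp at hx
  | cons a l ih =>
    rcases List.mem_cons.1 hx with rfl | h
    · simp
    · simp [ih h]

lemma slowTail_perm {n : ℕ} (m : ℕ)
    (ih : ∀ B : List ℕ, B.length < m → (slow B).Perm B) (r : List ℕ) (hr : r.length < m) :
    (slowTail n r).Perm (n :: r) := by
  induction hl : r.length using Nat.strong_induction_on generalizing r with
  | _ l ihl =>
    by_cases hn : n ∈ r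
    · obtain ⟨B, r', rfl, hB⟩ := List.eq_append_cons_of_mem hn
      rw [slowTail_append_cons hB]
      simp only [List.length_append, List.length_cons] at hr hl
      have h1 := ih B (by omega)
      have h2 := ihl r'.length (by omega) r' (by omega) rfl
      exact (h1.append (h2.cons n)).trans List.perm_middle
    · rw [slowTail_of_notMem hn]
      exact ((ih r hr).append_right [n]).trans (List.perm_append_singleton n r)

lemma slow_perm (w : List ℕ) : (slow w).Perm w := by
  induction hl : w.length using Nat.strong_induction_on generalizing w with
  | _ l ih =>
    rcases eq_or_ne w [] with rfl | hw
    · rw [slow_nil]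
    · obtain ⟨n, A, r, rfl, hA, hle⟩ := exists_split_max hw
      rw [slow_append_cons hA hle]
      simp only [List.length_append, List.length_cons] at hl
      exact (ih A.length (by omega) A rfl).append
        (slowTail_perm l (fun B hB => ih _ hB B rfl) r (by omega))

/-- `w` has no subsequence `a, b, c` with `c < a ≤ b`. -/
def AvoidsBoth (w : List ℕ) : Prop :=
  ∀ a b c, [a, b, c].Sublist w → a ≤ b → a ≤ c

lemma AvoidsBoth.sublist {v w : List ℕ} (hw : AvoidsBoth w) (h : v.Sublist w) : AvoidsBoth v :=
  fun a b c habc => hw a b c (habc.trans h)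

lemma avoidsBoth_max_cons {n : ℕ} {r : List ℕ} (hle : ∀ x ∈ r, x ≤ n) (hr : n ∉ r) :
    AvoidsBoth (n :: r) ↔ AvoidsBoth r := by
  refine ⟨fun h => h.sublist (List.sublist_cons_self n r), fun h a b c habc hab => ?_⟩
  rcases List.sublist_cons_iff.1 habc with h' | ⟨t, ht, h'⟩
  · exact h a b c h' hab
  · obtain ⟨rfl, rfl⟩ := List.cons.inj ht
    have hb : b ∈ r := h'.subset (by simp)
    exact absurd (le_antisymm (hle b hb) hab ▸ hb) hr

lemma avoidsBoth_append_max_cons {n : ℕ} {A r : List ℕ}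
    (hle : ∀ x ∈ A, x ≤ n) :
    AvoidsBoth (A ++ n :: r) ↔
      AvoidsBoth A ∧ AvoidsBoth (n :: r) ∧ ∀ a ∈ A, ∀ x ∈ r, a ≤ x := by
  constructor
  · intro h
    refine ⟨h.sublist (List.sublist_append_left _ _), h.sublist (List.sublist_append_right _ _),
      fun a ha x hx => h a n x ?_ (hle a ha)⟩
    exact (List.singleton_sublist.2 ha).append ((List.singleton_sublist.2 hx).cons_cons n)
  · rintro ⟨hA, hr, hAr⟩ a b c habc hab
    have hAr' : ∀ a ∈ A, ∀ x ∈ n :: r, a ≤ x := by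
      intro a ha x hx
      rcases List.mem_cons.1 hx with rfl | hx
      · exact hle a ha
      · exact hAr a ha x hx
    obtain ⟨l₁, l₂, h, h₁, h₂⟩ := List.sublist_append_iff.1 habc
    rcases l₁ with _ | ⟨a', _ | ⟨b', _ | ⟨c', l⟩⟩⟩
    · simp only [List.nil_append] at h
      exact hr a b c (h ▸ h₂) hab
    · simp only [List.cons_append, List.nil_append, List.cons.injEq] at h
      obtain ⟨rfl, rfl⟩ := h
      exact hAr' a (h₁.subset (by simp)) c (h₂.subset (by simp))
    · simp only [List.cons_append, List.nil_append, List.cons.injEq] at h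
      obtain ⟨rfl, rfl, rfl⟩ := h
      exact hAr' a (h₁.subset (by simp)) c (h₂.subset (by simp))
    · simp only [List.cons_append, List.cons.injEq] at h
      obtain ⟨rfl, rfl, rfl, -⟩ := h
      exact hA a b c ((List.prefix_append [a, b, c] l).sublist.trans h₁) hab

lemma avoidsBoth_of_forall_eq {n : ℕ} {r : List ℕ} (h : ∀ x ∈ r, x = n) : AvoidsBoth r :=
  fun a _ c habc _ =>
    ((h a (habc.subset (by simp))).trans (h c (habc.subset (by simp))).symm).le

lemma avoidsBoth_max_append_max {n : ℕ} {B r : List ℕ} (hle : ∀ x ∈ B ++ n :: r, x ≤ n)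
    (hB : n ∉ B) :
    AvoidsBoth (n :: (B ++ n :: r)) ↔ AvoidsBoth B ∧ ∀ x ∈ r, x = n := by
  have hleB : ∀ x ∈ B, x ≤ n := fun x hx => hle x (by simp [hx])
  have hcons : ∀ x ∈ n :: B, x ≤ n := by simpa using hleB
  rw [← List.cons_append, avoidsBoth_append_max_cons hcons, avoidsBoth_max_cons hleB hB]
  constructor
  · rintro ⟨h₁, -, h₂⟩
    exact ⟨h₁, fun x hx => le_antisymm (hle x (by simp [hx])) (h₂ n (by simp) x hx)⟩
  · rintro ⟨h₁, h₂⟩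
    refine ⟨h₁, avoidsBoth_of_forall_eq (n := n) (by simpa using h₂), fun a ha x hx => ?_⟩
    exact h₂ x hx ▸ hcons a ha

lemma pairwise_slowTail_iff {n : ℕ} {r : List ℕ} (hle : ∀ x ∈ r, x ≤ n)
    (ih : ∀ B : List ℕ, B.length ≤ r.length →
      ((slow B).Pairwise (· ≤ ·) ↔ AvoidsBoth B)) :
    (slowTail n r).Pairwise (· ≤ ·) ↔ AvoidsBoth (n :: r) := by
  by_cases hn : n ∈ r
  · obtain ⟨B, r', rfl, hB⟩ := List.eq_append_cons_of_mem hn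
    have hmem : ∀ x, x ∈ slowTail n r' ↔ x = n ∨ x ∈ r' := fun x =>
      (slowTail_perm (r'.length + 1) (fun B _ => slow_perm B) r' (by simp)).mem_iff.trans
        List.mem_cons
    rw [slowTail_append_cons hB, avoidsBoth_max_append_max hle hB, ← ih B (by simp),
      List.pairwise_append, List.pairwise_cons]
    simp only [(slow_perm B).mem_iff, List.mem_cons, hmem]
    simp only [List.mem_append, List.mem_cons] at hle
    constructor
    · rintro ⟨h₁, ⟨h₂, -⟩, -⟩
      exact ⟨h₁, fun x hx => le_antisymm (hle x (by simp [hx])) (h₂ x (by simp [hx]))⟩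
    · rintro ⟨h₁, h₂⟩
      refine ⟨h₁, ⟨?_, ?_⟩, ?_⟩
      · rintro x (rfl | hx)
        · exact le_rfl
        · exact (h₂ x hx).ge
      · have hconst : ∀ z ∈ slowTail n r', z = n := fun z hz =>
          ((hmem z).1 hz).elim id (h₂ z)
        refine List.pairwise_of_forall_mem_list fun x hx y hy => ?_
        rw [hconst x hx, hconst y hy]
      · intro a ha x hx
        have : x = n := by
          rcases hx with hx | hx | hx
          · exact hx
          · exact hx
          · exact h₂ x hx
        exact this ▸ hle a (Or.inl ha)
  · rw [slowTail_of_notMem hn, avoidsBoth_max_cons hle hn, ← ih r le_rfl, List.pairwise_append]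
    simpa [(slow_perm r).mem_iff] using fun _ => hle

theorem pairwise_slow_iff (w : List ℕ) : (slow w).Pairwise (· ≤ ·) ↔ AvoidsBoth w := by
  induction hl : w.length using Nat.strong_induction_on generalizing w with
  | _ l ih =>
    rcases eq_or_ne w [] with rfl | hw
    · simp [slow_nil, AvoidsBoth]
    · obtain ⟨n, A, r, rfl, hA, hle⟩ := exists_split_max hw
      simp only [List.length_append, List.length_cons] at hl
      have hleA : ∀ x ∈ A, x ≤ n := fun x hx => hle x (by simp [hx])
      have hler : ∀ x ∈ r, x ≤ n := fun x hx => hle x (by simp [hx])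
      have hmem : ∀ x, x ∈ slowTail n r ↔ x = n ∨ x ∈ r := fun x =>
        (slowTail_perm (r.length + 1) (fun B _ => slow_perm B) r (by simp)).mem_iff.trans
          List.mem_cons
      rw [slow_append_cons hA hle, avoidsBoth_append_max_cons hleA, List.pairwise_append,
        ih A.length (by omega) A rfl,
        pairwise_slowTail_iff hler fun B hB => ih B.length (by omega) B rfl]
      simp only [(slow_perm A).mem_iff, hmem]
      refine and_congr_right' (and_congr_right' ⟨fun h a ha x hx => h a ha x (Or.inr hx), ?_⟩)
      rintro h a ha x (rfl | hx)
      · exact hleA a ha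
      · exact h a ha x hx

lemma pair_sublist_iff_getD {b c : ℕ} {w : List ℕ} :
    [b, c].Sublist w ↔ ∃ j k, j < k ∧ k < w.length ∧ w.getD j 0 = b ∧ w.getD k 0 = c := by
  induction w with
  | nil => simp
  | cons x l ih =>
    rw [List.cons_sublist_cons']
    rw [ih, List.singleton_sublist]
    constructor
    · rintro (⟨j, k, hjk, hk, hj, hk'⟩ | ⟨rfl, hc⟩)
      · exact ⟨j + 1, k + 1, by omega, by simpa using hk, by simpa using hj, by simpa using hk'⟩
      · obtain ⟨k, hk, rfl⟩ := List.mem_iff_getElem.1 hc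
        exact ⟨0, k + 1, by omega, by simpa using hk, by simp, by simp [hk]⟩
    · rintro ⟨j, _ | k, hjk, hk, hj, hk'⟩
      · omega
      simp only [List.length_cons, add_lt_add_iff_right] at hk
      rcases j with _ | j
      · refine Or.inr ⟨by simpa using hj.symm, ?_⟩
        rw [List.getD_cons_succ, List.getD_eq_getElem _ _ hk] at hk'
        exact hk' ▸ List.getElem_mem hk
      · exact Or.inl ⟨j, k, by omega, hk, by simpa using hj, by simpa using hk'⟩

lemma triple_sublist_iff_getD {a b c : ℕ} {w : List ℕ} :
    [a, b, c].Sublist w ↔ ∃ i j k, i < j ∧ j < k ∧ k < w.length ∧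
      w.getD i 0 = a ∧ w.getD j 0 = b ∧ w.getD k 0 = c := by
  induction w with
  | nil => simp
  | cons x l ih =>
    rw [List.cons_sublist_cons', ih, pair_sublist_iff_getD]
    constructor
    · rintro (⟨i, j, k, hij, hjk, hk, ha, hb, hc⟩ | ⟨rfl, j, k, hjk, hk, hb, hc⟩)
      · exact ⟨i + 1, j + 1, k + 1, by omega, by omega, by simpa using hk, by simpa using ha,
          by simpa using hb, by simpa using hc⟩
      · exact ⟨0, j + 1, k + 1, by omega, by omega, by simpa using hk, by simp,
          by simpa using hb, by simpa using hc⟩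
    · rintro ⟨i, _ | j, _ | k, hij, hjk, hk, ha, hb, hc⟩
      all_goals try omega
      simp only [List.length_cons, add_lt_add_iff_right, List.getD_cons_succ] at hk hb hc
      rcases i with _ | i
      · exact Or.inr ⟨by simpa using ha.symm, j, k, by omega, hk, hb, hc⟩
      · exact Or.inl ⟨i, j, k, by omega, by omega, hk, by simpa using ha, hb, hc⟩

lemma avoidsBoth_iff {w : List ℕ} : AvoidsBoth w ↔ ¬Contains231 w ∧ ¬Contains221 w := by
  constructor
  · intro h
    constructor
    all_goals
      rintro ⟨i, j, k, hij, hjk, hk, hki, hij'⟩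
      exact hki.not_ge (h _ _ _ (triple_sublist_iff_getD.2 ⟨i, j, k, hij, hjk, hk, rfl, rfl, rfl⟩)
        hij'.le)
  · rintro ⟨h₁, h₂⟩ a b c habc hab
    obtain ⟨i, j, k, hij, hjk, hk, rfl, rfl, rfl⟩ := triple_sublist_iff_getD.1 habc
    by_contra! hlt
    rcases hab.lt_or_eq with hab | hab
    · exact h₁ ⟨i, j, k, hij, hjk, hk, hlt, hab⟩
    · exact h₂ ⟨i, j, k, hij, hjk, hk, hlt, hab⟩

lemma pairwise_idWord (c : List ℕ) : (idWord c).Pairwise (· ≤ ·) := by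
  rw [idWord, List.pairwise_flatten]
  refine ⟨?_, ?_⟩
  · simp [List.pairwise_replicate]
  · rw [List.pairwise_map]
    refine List.pairwise_lt_range.imp fun {i j} hij x hx y hy => ?_
    rw [List.eq_of_mem_replicate hx, List.eq_of_mem_replicate hy]
    omega

lemma count_idWord (c : List ℕ) (x : ℕ) :
    (idWord c).count x = if x = 0 then 0 else c.getD (x - 1) 0 := by
  have key : ∀ m, (((List.range m).map fun i =>
      List.replicate (c.getD i 0) (i + 1)).flatten).count x =
      if x ≠ 0 ∧ x ≤ m then c.getD (x - 1) 0 else 0 := by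
    intro m
    induction m with
    | zero => simp
    | succ m ih =>
      rw [List.range_succ, List.map_append, List.flatten_append, List.count_append, ih]
      simp only [List.map_cons, List.map_nil, List.flatten_cons, List.flatten_nil,
        List.append_nil, List.count_replicate, beq_iff_eq]
      by_cases hx : x = m + 1
      · subst hx; simp
      · rw [if_neg (Ne.symm hx), add_zero]
        exact if_congr (by omega) rfl rfl
  rw [idWord, key]
  split_ifs with h₁ h₂ h₂
  · exact absurd h₂ h₁.1
  · rfl
  · rfl
  · exact (List.getD_eq_default _ _ (by omega)).symm

lemma InW.perm_idWord {c w : List ℕ} (hw : InW c w) : w.Perm (idWord c) := by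
  rw [List.perm_iff_count]
  rintro (_ | i)
  · simpa [count_idWord] using List.count_eq_zero.2 hw.1
  · simpa [count_idWord] using hw.2 i

/-- Let `c = (c₁, …, c_n)` be a tuple of nonnegative integers and let `w ∈ W_c`.
Then `slow w = Id_c` if and only if `w` avoids both patterns `231` and `221`. -/
theorem slow_sortable_iff_avoids_231_221 (c : List ℕ) (w : List ℕ) (hw : InW c w) :
    slow w = idWord c ↔ ¬Contains231 w ∧ ¬Contains221 w := by
  rw [← avoidsBoth_iff, ← pairwise_slow_iff]
  refine ⟨fun h => h ▸ pairwise_idWord c, fun h => ?_⟩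
  exact ((slow_perm w).trans hw.perm_idWord).eq_of_pairwise
    (fun _ _ _ _ h₁ h₂ => le_antisymm h₁ h₂) h (pairwise_idWord c)
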